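/- Assume that the image of r in the quotient group (ℤ/pℤ)^×/⟨ℓ⟩ has order m (equivalently, C_m permutes the (p − 1)/f Frobenius orbits of nontrivial characters of C_p in orbits of full size m). Then there is an F-algebra isomorphism A ≅ F[X]/(X^m − λ) × ∏_{j=1}^{(p−1)/(f·m)} M_m(K_j), where each K_j is a field extension of F of degree f. -/

import Mathlib

open Polynomial in
/-- Clock and shift matrices: if `d` is `m`-periodic with `d n = d (n + 1) ^ r`, there are
`m × m` matrices `X, Y` with `Y X = X ^ r Y` and `Y ^ m = μ`, where `X` is diagonal with
entries `d n` and `Y` is a scaled cyclic shift. -/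
theorem exists_clock_shift_matrices {K : Type*} [Field K] {m p r : ℕ} (hm : m ≠ 0) {μ : K}
    (hμ : μ ≠ 0) {d : ℕ → K} (hper : d.Periodic m) (hd : ∀ n, d n = d (n + 1) ^ r)
    (hdp : ∀ n, d n ^ p = 1) :
    ∃ X Y : Matrix (Fin m) (Fin m) K, X ^ p = 1 ∧ Y ^ m = algebraMap K _ μ ∧
      Y * X = X ^ r * Y ∧ ∀ C : Fin m → K[X], ∑ l, aeval X (C l) * Y ^ (l : ℕ) = 0 →
        ∀ l t, (C l).eval (d (t + l)) = 0 := by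
  have hmonic : (Polynomial.X ^ m - C μ).Monic := monic_X_pow_sub_C μ hm
  have hnat : (AdjoinRoot.powerBasis' hmonic).dim = m := by
    simp [AdjoinRoot.powerBasis'_dim]
  let b := (AdjoinRoot.powerBasis' hmonic).basis.reindex (finCongr hnat)
  set θ := AdjoinRoot.root (Polynomial.X ^ m - C μ) with hθ
  have hb : ∀ i : Fin m, b i = θ ^ (i : ℕ) := fun i => by simp [b, hθ]
  have hθm : θ ^ m = algebraMap K _ μ := by
    have h := AdjoinRoot.eval₂_root (Polynomial.X ^ m - C μ)
    simpa [sub_eq_zero] using h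
  have hθu : IsUnit θ := by
    rw [← isUnit_pow_iff hm, hθm]
    exact (IsUnit.mk0 μ hμ).map _
  let X : Module.End K (AdjoinRoot (Polynomial.X ^ m - C μ)) := b.constr K fun i => d i • b i
  let Y : Module.End K (AdjoinRoot (Polynomial.X ^ m - C μ)) := LinearMap.mulLeft K θ
  have hX : ∀ n, X (θ ^ n) = d n • θ ^ n := by
    intro n
    have hn : θ ^ n = μ ^ (n / m) • b ⟨n % m, Nat.mod_lt _ (Nat.pos_of_ne_zero hm)⟩ := by
      rw [hb, Algebra.smul_def, map_pow, ← hθm, ← pow_mul, ← pow_add, Nat.div_add_mod]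
    rw [hn, map_smul, Module.Basis.constr_basis, hper.map_mod_nat, smul_comm]
  have hY : ∀ l n, (Y ^ l) (θ ^ n) = θ ^ (n + l) := by
    intro l n
    simp [Y, LinearMap.pow_mulLeft, pow_add, mul_comm]
  have hXp : ∀ k n, (X ^ k) (θ ^ n) = d n ^ k • θ ^ n := by
    intro k n
    induction k with
    | zero => simp
    | succ k ih => rw [pow_succ', Module.End.mul_apply, ih, map_smul, hX, smul_smul, pow_succ]
  have hXa : ∀ (c : K[X]) n, aeval X c (θ ^ n) = c.eval (d n) • θ ^ n := by
    intro c n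
    induction c using Polynomial.induction_on' with
    | add p q hp hq => simp [hp, hq, add_smul]
    | monomial k a => simp [aeval_monomial, hXp, smul_smul, mul_comm]
  have hext : ∀ S T : Module.End K (AdjoinRoot (Polynomial.X ^ m - C μ)),
      (∀ n, S (θ ^ n) = T (θ ^ n)) → S = T := fun S T h =>
    b.ext fun i => by rw [hb, h]
  let e := algEquivMatrix b
  refine ⟨e X, e Y, ?_, ?_, ?_, ?_⟩
  · rw [← map_pow, ← map_one e]
    congr 1
    exact hext _ _ fun n => by simp [hXp, hdp]
  · rw [← map_pow, ← e.commutes]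
    congr 1
    exact hext _ _ fun n => by
      rw [hY, pow_add, hθm, mul_comm, ← Algebra.smul_def, Module.algebraMap_end_apply]
  · rw [← map_pow, ← map_mul, ← map_mul]
    congr 1
    refine hext _ _ fun n => ?_
    have hY1 := hY 1
    simp only [pow_one] at hY1
    simp only [Module.End.mul_apply, hX, hY1, hXp, map_smul, ← hd]
  · intro c hc l t
    have hsum : ∑ l, aeval X (c l) * Y ^ (l : ℕ) = 0 := by
      apply e.injective
      rw [map_sum, map_zero, ← hc]
      refine Finset.sum_congr rfl fun l _ => ?_
      rw [map_mul, map_pow, aeval_algHom_apply e]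
    have h := LinearMap.congr_fun hsum (θ ^ t)
    simp only [LinearMap.sum_apply, Module.End.mul_apply, hY, hXa, LinearMap.zero_apply] at h
    have h' : ∑ l : Fin m, (c l).eval (d (t + l)) • b l = 0 := by
      apply (hθu.pow t).mul_left_cancel
      rw [Finset.mul_sum, mul_zero, ← h]
      refine Finset.sum_congr rfl fun l _ => ?_
      rw [hb, mul_smul_comm, pow_add]
    exact Fintype.linearIndependent_iff.mp b.linearIndependent _ h' l

theorem pow_mul_pow_eq_smul_mod {F R : Type*} [CommRing F] [Ring R] [Algebra F R] {p m : ℕ}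
    {lam : F} {s t : R} (hs : s ^ p = 1) (ht : t ^ m = algebraMap F R lam) (i j : ℕ) :
    s ^ i * t ^ j = lam ^ (j / m) • (s ^ (i % p) * t ^ (j % m)) := by
  conv_lhs => rw [← Nat.div_add_mod i p, ← Nat.div_add_mod j m, pow_add, pow_add, pow_mul,
    pow_mul, hs, one_pow, one_mul, ht, ← map_pow, ← Algebra.smul_def, mul_smul_comm]

theorem pow_mul_pow_of_mul_eq_pow_mul {M : Type*} [Monoid M] {r : ℕ} {s t : M}
    (h : t * s = s ^ r * t) (i j : ℕ) : t ^ j * s ^ i = s ^ (r ^ j * i) * t ^ j := by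
  have h1 : ∀ i, t * s ^ i = s ^ (r * i) * t := fun i => by
    rw [pow_mul]
    exact SemiconjBy.pow_right (h : SemiconjBy t s (s ^ r)) i
  induction j with
  | zero => simp
  | succ j ih => rw [pow_succ', mul_assoc, ih, ← mul_assoc, h1, mul_assoc, pow_succ', mul_assoc]

theorem pow_mul_pow_mul_pow_mul_pow {M : Type*} [Monoid M] {r : ℕ} {s t : M}
    (h : t * s = s ^ r * t) (i j i' j' : ℕ) :
    s ^ i * t ^ j * (s ^ i' * t ^ j') = s ^ (i + r ^ j * i') * t ^ (j + j') := by
  rw [mul_assoc, ← mul_assoc (t ^ j), pow_mul_pow_of_mul_eq_pow_mul h, pow_add, pow_add]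
  simp only [mul_assoc]

/-- Universal property of an algebra with basis `x ^ i * y ^ j` subject to the relations
`x ^ p = 1`, `y ^ m = lam`, `y * x = x ^ r * y`. -/
theorem exists_algHom_of_metacyclic_relations {F A B : Type*} [CommRing F] [Ring A] [Algebra F A]
    [Ring B] [Algebra F B] {p m r : ℕ} [NeZero p] [NeZero m] {lam : F} {x y : A}
    (bs : Module.Basis (Fin p × Fin m) F A)
    (hbs : ∀ k, bs k = x ^ (k.1 : ℕ) * y ^ (k.2 : ℕ))
    (hx : x ^ p = 1) (hy : y ^ m = algebraMap F A lam) (hyx : y * x = x ^ r * y)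
    {X Y : B} (hX : X ^ p = 1) (hY : Y ^ m = algebraMap F B lam) (hYX : Y * X = X ^ r * Y) :
    ∃ φ : A →ₐ[F] B, φ x = X ∧ φ y = Y := by
  let φ : A →ₗ[F] B := bs.constr F fun k => X ^ (k.1 : ℕ) * Y ^ (k.2 : ℕ)
  have hφ : ∀ i j : ℕ, φ (x ^ i * y ^ j) = X ^ i * Y ^ j := by
    intro i j
    have hb := bs.constr_basis F (fun k => X ^ (k.1 : ℕ) * Y ^ (k.2 : ℕ))
      (Fin.ofNat p i, Fin.ofNat m j)
    rw [hbs] at hb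
    rw [pow_mul_pow_eq_smul_mod hx hy, map_smul, pow_mul_pow_eq_smul_mod hX hY i j]
    exact congrArg _ hb
  have hmul : ∀ z w, φ (z * w) = φ z * φ w := by
    have : (LinearMap.mul F A).compr₂ φ = (LinearMap.mul F B).compl₁₂ φ φ := by
      refine bs.ext fun k => bs.ext fun k' => ?_
      simp only [LinearMap.compr₂_apply, LinearMap.mul_apply', LinearMap.compl₁₂_apply, hbs, hφ]
      rw [pow_mul_pow_mul_pow_mul_pow hyx, pow_mul_pow_mul_pow_mul_pow hYX, hφ]
    intro z w
    exact LinearMap.congr_fun₂ this z w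
  refine ⟨AlgHom.ofLinearMap φ ?_ hmul, ?_, ?_⟩
  · simpa using hφ 0 0
  · simpa using hφ 1 0
  · simpa using hφ 0 1

/-- A transversal of the subgroup generated by `s` and `q`, when the image of `s` modulo `q` has
order `m`. -/
theorem exists_transversal_of_orderOf_mk {U : Type*} [CommGroup U] [Finite U] (s q : U) {m : ℕ}
    (h : orderOf (QuotientGroup.mk s : U ⧸ Subgroup.zpowers q) = m) :
    orderOf q * m ∣ Nat.card U ∧ ∃ k : Fin (Nat.card U / (orderOf q * m)) → U,
      ∀ v, ∃ j, ∃ n t : ℕ, v = k j * s ^ n * q ^ t := by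
  let H : Subgroup U := (Subgroup.zpowers (QuotientGroup.mk s : U ⧸ Subgroup.zpowers q)).comap
    (QuotientGroup.mk' _)
  have hQ := Subgroup.card_mul_index (Subgroup.zpowers q)
  have hQ' := Subgroup.card_mul_index (Subgroup.zpowers (QuotientGroup.mk s : U ⧸ Subgroup.zpowers q))
  rw [Nat.card_zpowers] at hQ hQ'
  have hH : H.index = _ := Subgroup.index_comap_of_surjective _ (QuotientGroup.mk'_surjective _)
  have hU : orderOf q * m * H.index = Nat.card U := by
    rw [hH, ← hQ, mul_assoc, ← h, hQ', Subgroup.index]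
  have hpos : 0 < orderOf q * m := by
    rw [← h]; exact Nat.mul_pos (orderOf_pos _) (orderOf_pos _)
  refine ⟨⟨_, hU.symm⟩, ?_⟩
  rw [← hU, Nat.mul_div_cancel_left _ hpos]
  let e : Fin H.index ≃ U ⧸ H := (Finite.equivFin _).symm
  refine ⟨fun j => (e j).out, fun v => ⟨e.symm (QuotientGroup.mk v), ?_⟩⟩
  have hv : ((e (e.symm (QuotientGroup.mk v))).out)⁻¹ * v ∈ H := by
    rw [← QuotientGroup.eq]; simp
  obtain ⟨n, hn⟩ := mem_powers_iff_mem_zpowers.mpr (Subgroup.mem_comap.mp hv)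
  beta_reduce
  generalize (e (e.symm (QuotientGroup.mk v))).out = w at hn hv ⊢
  have h2 : (QuotientGroup.mk (s ^ n) : U ⧸ Subgroup.zpowers q) = QuotientGroup.mk (w⁻¹ * v) := hn
  rw [QuotientGroup.eq] at h2
  obtain ⟨t, ht⟩ := mem_powers_iff_mem_zpowers.mpr h2
  refine ⟨n, t, ?_⟩
  simp only at ht
  rw [ht]; group

/-- The roots of a polynomial over a finite field are stable under Frobenius. -/
theorem aeval_pow_card_pow_eq_zero {F K : Type*} [Field F] [Fintype F] [CommRing K] [Algebra F K]
    {c : Polynomial F} {z : K} (h : Polynomial.aeval z c = 0) (t : ℕ) :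
    Polynomial.aeval (z ^ Fintype.card F ^ t) c = 0 := by
  induction t with
  | zero => simpa
  | succ t ih =>
    have := Polynomial.aeval_algHom_apply (FiniteField.frobeniusAlgHom F K)
      (z ^ Fintype.card F ^ t) c
    rw [ih, map_zero, FiniteField.coe_frobeniusAlgHom] at this
    rwa [pow_succ, pow_mul]

open Polynomial in
/-- Writing elements of an algebra with basis `x ^ i * y ^ j` as polynomials in `y` on the right
with coefficients in `F[x]`. -/
theorem exists_eq_sum_aeval_mul_pow {F A : Type*} [CommRing F] [Ring A] [Algebra F A] {p m : ℕ}
    {x y : A} (bs : Module.Basis (Fin p × Fin m) F A)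
    (hbs : ∀ k, bs k = x ^ (k.1 : ℕ) * y ^ (k.2 : ℕ)) (z : A) :
    ∃ c : Fin m → F[X], (∀ l, (c l).degree < p) ∧ z = ∑ l, aeval x (c l) * y ^ (l : ℕ) := by
  refine ⟨fun l => ∑ i : Fin p, monomial i (bs.repr z (i, l)), fun l => ?_, ?_⟩
  · exact mem_degreeLT.mp (Submodule.sum_mem _ fun i _ => mem_degreeLT.mpr
      (lt_of_le_of_lt (degree_monomial_le _ _) (by exact_mod_cast i.2)))
  · conv_lhs => rw [← bs.sum_repr z, Fintype.sum_prod_type_right]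
    refine Finset.sum_congr rfl fun l _ => ?_
    rw [map_sum, Finset.sum_mul]
    refine Finset.sum_congr rfl fun i _ => ?_
    rw [aeval_monomial, hbs, ← Algebra.smul_def, smul_mul_assoc]

theorem FiniteField.exists_extension_isPrimitiveRoot (F : Type) [Field F] [Fintype F] {p : ℕ}
    (hp : p.Prime) {f : ℕ} (hf : f ≠ 0) (hpf : (Fintype.card F : ZMod p) ^ f = 1) :
    ∃ (K : Type) (_ : Field K) (_ : Algebra F K), Module.finrank F K = f ∧
      ∃ ζ : K, IsPrimitiveRoot ζ p := by
  have : NeZero f := ⟨hf⟩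
  have := Fact.mk (CharP.char_is_prime F (ringChar F))
  have := Fact.mk hp
  let K := FiniteField.Extension F (ringChar F) f
  refine ⟨K, inferInstance, inferInstance, FiniteField.finrank_extension _ _ _, ?_⟩
  have hcard : Nat.card K = Fintype.card F ^ f := by
    rw [FiniteField.natCard_extension, Nat.card_eq_fintype_card]
  have hdvd : p ∣ Nat.card Kˣ := by
    have := Fintype.ofFinite K
    rw [Nat.card_units, hcard, ← ZMod.natCast_eq_zero_iff,
      Nat.cast_sub (Nat.one_le_pow _ _ Fintype.card_pos)]
    simp [hpf]
  obtain ⟨ζ, hζ⟩ := exists_prime_orderOf_dvd_card' p hdvd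
  exact ⟨ζ, IsPrimitiveRoot.coe_units_iff.mpr (hζ ▸ IsPrimitiveRoot.orderOf ζ)⟩

open Polynomial in
/-- Wedderburn decomposition of the algebra with basis `x ^ i * y ^ j` and relations `x ^ p = 1`,
`y ^ m = lam`, `y * x = x ^ r * y`. -/
theorem nonempty_algEquiv_adjoinRoot_prod_matrix {F A K : Type*} [Field F] [Fintype F] [Ring A]
    [Algebra F A] [Field K] [Algebra F K] {p m r : ℕ} (hp : p.Prime) (hm : m ≠ 0)
    (lam : Fˣ) {x y : A} (bs : Module.Basis (Fin p × Fin m) F A)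
    (hbs : ∀ k, bs k = x ^ (k.1 : ℕ) * y ^ (k.2 : ℕ))
    (hx : x ^ p = 1) (hy : y ^ m = algebraMap F A lam) (hyx : y * x = x ^ r * y)
    {ζ : K} (hζ : IsPrimitiveRoot ζ p) (ru ℓu : (ZMod p)ˣ)
    (hru : (ru : ZMod p) = (r : ZMod p)) (hℓu : (ℓu : ZMod p) = (Fintype.card F : ZMod p))
    (hrm : ru ^ m = 1) (hK : Module.finrank F K = orderOf ℓu)
    (htrans : orderOf (QuotientGroup.mk ru : (ZMod p)ˣ ⧸ Subgroup.zpowers ℓu) = m) :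
    Nonempty (A ≃ₐ[F] AdjoinRoot (X ^ m - C (lam : F)) ×
      (Fin ((p - 1) / (orderOf ℓu * m)) → Matrix (Fin m) (Fin m) K)) := by
  have := Fact.mk hp
  have : NeZero m := ⟨hm⟩
  have hinv : orderOf (QuotientGroup.mk ru⁻¹ : (ZMod p)ˣ ⧸ Subgroup.zpowers ℓu) = m := by
    rw [QuotientGroup.mk_inv, orderOf_inv, htrans]
  obtain ⟨hdvd, k, hk⟩ := exists_transversal_of_orderOf_mk ru⁻¹ ℓu hinv
  have hU : Nat.card (ZMod p)ˣ = p - 1 := by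
    rw [Nat.card_eq_fintype_card, ZMod.card_units]
  rw [hU] at hdvd
  rw [← hU]
  let ψ := AddChar.zmodChar p hζ.pow_eq_one
  let d (j) (n : ℕ) : K := ψ ((k j * ru⁻¹ ^ n : (ZMod p)ˣ) : ZMod p)
  have hψ : ∀ (n : ℕ) (z : ZMod p), ψ (n * z) = ψ z ^ n := fun n z => by
    rw [← nsmul_eq_mul, AddChar.map_nsmul_eq_pow]
  have hlam : algebraMap F K lam ≠ 0 := by simp
  have hrep := fun j => exists_clock_shift_matrices (p := p) (r := r) hm hlam (d := d j)
    (fun n => by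
      change ψ _ = ψ _
      rw [pow_add, inv_pow _ m, hrm, inv_one, mul_one])
    (fun n => by
      change ψ _ = ψ _ ^ r
      rw [← hψ, ← hru, ← Units.val_mul]
      congr 2
      rw [pow_succ, ← mul_assoc (k j), mul_comm ru, inv_mul_cancel_right])
    (fun n => by
      change ψ _ ^ p = 1
      rw [← hψ]; simp)
  choose X' Y' hX' hY' hYX' hind using hrep
  have hmonic : (X ^ m - C (lam : F)).Monic := monic_X_pow_sub_C _ hm
  have hroot : AdjoinRoot.root (X ^ m - C (lam : F)) ^ m = algebraMap F _ lam := by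
    have h := AdjoinRoot.eval₂_root (X ^ m - C (lam : F))
    simpa [sub_eq_zero] using h
  obtain ⟨φ₀, hφ₀x, hφ₀y⟩ := exists_algHom_of_metacyclic_relations bs hbs hx hy hyx
    (X := (1 : AdjoinRoot (X ^ m - C (lam : F)))) (by simp) hroot (by simp)
  have hφ := fun j => exists_algHom_of_metacyclic_relations bs hbs hx hy hyx
    (hX' j) ((hY' j).trans (IsScalarTower.algebraMap_apply F K _ _).symm) (hYX' j)
  choose φ hφx hφy using hφ
  let Φ := φ₀.prod (AlgHom.pi φ)
  have hinj : Function.Injective Φ := by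
    rw [injective_iff_map_eq_zero]
    intro z hz
    obtain ⟨c, hc, rfl⟩ := exists_eq_sum_aeval_mul_pow bs hbs z
    refine Finset.sum_eq_zero fun l _ => ?_
    suffices c l = 0 by simp [this]
    have hz₀ : ∑ l, aeval (1 : F) (c l) • AdjoinRoot.root (X ^ m - C (lam : F)) ^ (l : ℕ) = 0 := by
      have h : φ₀ _ = 0 := congrArg Prod.fst hz
      rw [map_sum] at h
      rw [← h]
      refine Finset.sum_congr rfl fun l _ => ?_
      rw [map_mul, map_pow, ← aeval_algHom_apply, hφ₀x, hφ₀y, Algebra.smul_def,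
        ← aeval_algebraMap_apply, map_one]
    have hc₀ : aeval (1 : F) (c l) = 0 := by
      have hnat : (AdjoinRoot.powerBasis' hmonic).dim = m := by
        simp [AdjoinRoot.powerBasis'_dim]
      let b := (AdjoinRoot.powerBasis' hmonic).basis.reindex (finCongr hnat)
      refine Fintype.linearIndependent_iff.mp b.linearIndependent
        (fun l => aeval (1 : F) (c l)) ?_ l
      simpa [b] using hz₀
    have hcd : ∀ j n, aeval (d j n) (c l) = 0 := by
      intro j n
      have h : φ j _ = 0 := congrFun (congrArg Prod.snd hz) j
      have h' : ∑ l, aeval (X' j) ((c l).map (algebraMap F K)) * Y' j ^ (l : ℕ) = 0 := by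
        simpa [← aeval_algHom_apply, hφx, hφy, aeval_map_algebraMap] using h
      have hn := hind j (fun l => (c l).map (algebraMap F K)) h' l (n + l * m - l)
      have hper : d j (n + l * m - l + l) = d j n := by
        rw [Nat.sub_add_cancel (le_add_left (Nat.le_mul_of_pos_right _ (Nat.pos_of_ne_zero hm)))]
        change ψ _ = ψ _
        rw [pow_add, mul_comm (l : ℕ), pow_mul ru⁻¹ m, inv_pow _ m, hrm, inv_one, one_pow, mul_one]
      rw [hper, eval_map_algebraMap] at hn
      exact hn
    have hall : ∀ v : ZMod p, aeval (ψ v) (c l) = 0 := by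
      intro v
      rcases eq_or_ne v 0 with rfl | hv
      · rw [AddChar.map_zero_eq_one, ← map_one (algebraMap F K), aeval_algebraMap_apply, hc₀,
          map_zero]
      · obtain ⟨j, n, t, hjnt⟩ := hk (Units.mk0 v hv)
        have hv' : v = (Fintype.card F ^ t : ℕ) * ((k j * ru⁻¹ ^ n : (ZMod p)ˣ) : ZMod p) := by
          rw [← Units.val_mk0 hv, hjnt, Units.val_mul _ (ℓu ^ t), Units.val_pow_eq_pow_val ℓu,
            hℓu, mul_comm, Nat.cast_pow]
        rw [hv', hψ]
        exact aeval_pow_card_pow_eq_zero (hcd j n) t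
    have hψinj : Function.Injective ψ := by
      intro v w hvw
      rw [AddChar.zmodChar_apply, AddChar.zmodChar_apply] at hvw
      exact ZMod.val_injective p (hζ.pow_inj (ZMod.val_lt v) (ZMod.val_lt w) hvw)
    by_contra hne
    refine hne ((Polynomial.map_eq_zero (algebraMap F K)).mp ?_)
    refine eq_zero_of_natDegree_lt_card_of_eval_eq_zero ((c l).map (algebraMap F K)) hψinj
      (fun v => by rw [eval_map_algebraMap, hall]) ?_
    rw [natDegree_map, ZMod.card]
    exact (natDegree_lt_iff_degree_lt hne).mpr (hc l)
  have : Module.Free F (AdjoinRoot (X ^ m - C (lam : F))) := .of_basis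
    (AdjoinRoot.powerBasis' hmonic).basis
  have : Module.Finite F (AdjoinRoot (X ^ m - C (lam : F))) :=
    (AdjoinRoot.powerBasis' hmonic).finite
  have : Module.Finite F K := Module.finite_of_finrank_pos (hK ▸ orderOf_pos ℓu)
  have : Module.Finite F (Matrix (Fin m) (Fin m) K) :=
    inferInstanceAs (Module.Finite F (Fin m → Fin m → K))
  have hdim : Module.finrank F A = Module.finrank F (AdjoinRoot (X ^ m - C (lam : F)) ×
      (Fin (Nat.card (ZMod p)ˣ / (orderOf ℓu * m)) → Matrix (Fin m) (Fin m) K)) := by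
    rw [Module.finrank_prod, Module.finrank_pi_fintype, Module.finrank_eq_card_basis bs,
      (AdjoinRoot.powerBasis' hmonic).finrank]
    simp only [Module.finrank_matrix, hK, Finset.sum_const, Finset.card_univ, Fintype.card_fin,
      Fintype.card_prod, AdjoinRoot.powerBasis'_dim, natDegree_X_pow_sub_C, smul_eq_mul, hU]
    obtain ⟨N, hN⟩ := hdvd
    rw [hN, Nat.mul_div_cancel_left _ (Nat.mul_pos (orderOf_pos _) (Nat.pos_of_ne_zero hm))]
    have : p = 1 + orderOf ℓu * m * N := by have := hp.pos; omega
    conv_lhs => rw [this]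
    ring
  have : Module.Finite F A := .of_basis bs
  exact ⟨AlgEquiv.ofBijective Φ ⟨hinj,
    (LinearMap.injective_iff_surjective_of_finrank_eq_finrank hdim (f := Φ.toLinearMap)).mp hinj⟩⟩

/-- **transitive case.** With `G = C_p ⋊_r C_m`, `F` a finite field
with `ℓ` elements of characteristic different from `p`, `α` the inflation of `α_λ`
along `G → C_m`, `A = F^α G` the twisted group algebra, and `f = ord_p(ℓ)`: if the
image of `r` in `(ℤ/pℤ)^×/⟨ℓ⟩` has order `m` (i.e. `C_m` permutes the `(p-1)/f`
Frobenius orbits of nontrivial characters of `C_p` in orbits of full size `m`), then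
`A ≅ F[X]/(X^m - λ) × ∏_{j=1}^{(p-1)/(f·m)} M_m(K_j)` as `F`-algebras, where each
`K_j` is a field extension of `F` of degree `f`. -/
theorem twisted_group_algebra_wedderburn_transitive (p m r ℓ : ℕ)
    (hp : p.Prime) (hodd : Odd p)
    (hm : 1 < m) (hmp : m ∣ p - 1)
    (hr : orderOf ((r : ZMod p)) = m)
    (G : Type) [Group G] (a b : G)
    (ha : orderOf a = p) (hb : orderOf b = m)
    (hrel : b * a * b⁻¹ = a ^ r)
    (hgen : ∀ g : G, ∃ i j : ℕ, g = a ^ i * b ^ j)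
    (hcard : Nat.card G = p * m)
    (F : Type) [Field F] [Fintype F]
    (hF : Fintype.card F = ℓ) (hchar : ringChar F ≠ p)
    (lam : Fˣ)
    (α : G → G → Fˣ)
    (hα : ∀ i₁ j₁ i₂ j₂ : ℕ, i₁ < p → j₁ < m → i₂ < p → j₂ < m →
      α (a ^ i₁ * b ^ j₁) (a ^ i₂ * b ^ j₂) = if j₁ + j₂ < m then 1 else lam)
    (A : Type) [Ring A] [Algebra F A]
    (u : G → A)
    (hlin : LinearIndependent F u)
    (hspan : Submodule.span F (Set.range u) = ⊤)
    (hone : u 1 = 1)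
    (hmul : ∀ g h : G, u g * u h = ((α g h : F)) • u (g * h))
    (ru ℓu : (ZMod p)ˣ)
    (hru : (ru : ZMod p) = (r : ZMod p)) (hℓu : (ℓu : ZMod p) = (ℓ : ZMod p))
    (f : ℕ) (hf : f = orderOf ((ℓ : ZMod p)))
    (htrans : orderOf (QuotientGroup.mk ru : (ZMod p)ˣ ⧸ Subgroup.zpowers ℓu) = m) :
    ∃ (K : Fin ((p - 1) / (f * m)) → Type)
        (_ : ∀ j, Field (K j)) (_ : ∀ j, Algebra F (K j)),
      (∀ j, Module.finrank F (K j) = f) ∧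
      Nonempty (A ≃ₐ[F]
        (Polynomial F ⧸ Ideal.span
            ({Polynomial.X ^ m - Polynomial.C ((lam : F))} : Set (Polynomial F))) ×
          ((j : Fin ((p - 1) / (f * m))) → Matrix (Fin m) (Fin m) (K j))) := by
  have := Fact.mk hp
  have hp0 := hp.pos
  have hm0 : 0 < m := by omega
  have : NeZero p := ⟨hp0.ne'⟩
  subst hF
  have hu : ∀ i₁ j₁ i₂ j₂ : ℕ, i₁ < p → j₁ < m → i₂ < p → j₂ < m →
      u (a ^ i₁ * b ^ j₁) * u (a ^ i₂ * b ^ j₂) =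
        (if j₁ + j₂ < m then (1 : F) else lam) • u (a ^ i₁ * b ^ j₁ * (a ^ i₂ * b ^ j₂)) := by
    intro i₁ j₁ i₂ j₂ h₁ h₂ h₃ h₄
    rw [hmul, hα _ _ _ _ h₁ h₂ h₃ h₄]
    split_ifs <;> simp
  have hua : ∀ i, i < p → u a ^ i = u (a ^ i) := by
    intro i
    induction i with
    | zero => simp [hone]
    | succ i ih =>
      intro hi
      have h := hu i 0 1 0 (by omega) hm0 hp.one_lt hm0
      simp only [pow_zero, mul_one, pow_one, add_zero, hm0, if_true, one_smul] at h
      rw [pow_succ, ih (by omega), h, pow_succ]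
  have hub : ∀ j, j < m → u b ^ j = u (b ^ j) := by
    intro j
    induction j with
    | zero => simp [hone]
    | succ j ih =>
      intro hj
      have h := hu 0 j 0 1 hp0 (by omega) hp0 hm
      simp only [pow_zero, one_mul, pow_one, hj, if_true, one_smul] at h
      rw [pow_succ, ih (by omega), h, pow_succ]
  have huab : ∀ i j, i < p → j < m → u a ^ i * u b ^ j = u (a ^ i * b ^ j) := by
    intro i j hi hj
    have h := hu i 0 0 j hi hm0 hp0 hj
    simp only [pow_zero, one_mul, mul_one, zero_add, hj, if_true, one_smul] at h
    rw [hua i hi, hub j hj, h]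
  have hx : u a ^ p = 1 := by
    have h := hu (p - 1) 0 1 0 (by omega) hm0 hp.one_lt hm0
    simp only [pow_zero, mul_one, pow_one, add_zero, hm0, if_true, one_smul] at h
    rw [← hua _ (by omega), ← pow_succ, ← pow_succ, Nat.sub_add_cancel hp0, ← ha,
      pow_orderOf_eq_one, hone] at h
    rw [← ha, h]
  have hy : u b ^ m = algebraMap F A lam := by
    have h := hu 0 (m - 1) 0 1 hp0 (by omega) hp0 hm
    rw [if_neg (by omega)] at h
    simp only [pow_zero, one_mul, pow_one] at h
    rw [← hub _ (by omega), ← pow_succ, ← pow_succ, Nat.sub_add_cancel hm0, ← hb,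
      pow_orderOf_eq_one, hone, ← Algebra.algebraMap_eq_smul_one] at h
    rw [← hb, h]
  have hyx : u b * u a = u a ^ r * u b := by
    have h := hu 0 1 1 0 hp0 hm hp.one_lt hm0
    simp only [pow_zero, mul_one, one_mul, pow_one, add_zero, hm, if_true, one_smul] at h
    have h' := huab (r % p) 1 (Nat.mod_lt _ hp0) hm
    have hr' : u a ^ (r % p) = u a ^ r := (pow_eq_pow_mod r hx).symm
    have ha' : a ^ (r % p) = a ^ r := by rw [← ha, pow_mod_orderOf]
    rw [hr', ha', pow_one, pow_one, ← hrel, inv_mul_cancel_right] at h'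
    rw [h, h']
  have hsurj : Function.Surjective fun k : Fin p × Fin m => a ^ (k.1 : ℕ) * b ^ (k.2 : ℕ) := by
    intro g
    obtain ⟨i, j, rfl⟩ := hgen g
    refine ⟨(⟨i % p, Nat.mod_lt _ hp0⟩, ⟨j % m, Nat.mod_lt _ hm0⟩), ?_⟩
    simp only
    rw [← ha, pow_mod_orderOf, ← hb, pow_mod_orderOf]
  have : Finite G := .of_surjective _ hsurj
  let e := Equiv.ofBijective _ ((Nat.bijective_iff_surjective_and_card _).mpr
    ⟨hsurj, by simp [hcard]⟩)
  let bs : Module.Basis (Fin p × Fin m) F A :=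
    (Module.Basis.mk hlin hspan.ge).reindex e.symm
  have hbs : ∀ k, bs k = u a ^ (k.1 : ℕ) * u b ^ (k.2 : ℕ) := by
    intro k
    rw [huab _ _ k.1.2 k.2.2]
    simp [bs, e]
  have hfu : f = orderOf ℓu := by rw [hf, ← hℓu, orderOf_units]
  have hrm : ru ^ m = 1 := by
    rw [← hr, ← hru, orderOf_units, pow_orderOf_eq_one]
  obtain ⟨K, _, _, hK, ζ, hζ⟩ := FiniteField.exists_extension_isPrimitiveRoot F hp
    (f := f) (hfu ▸ (orderOf_pos ℓu).ne') (by rw [hf, pow_orderOf_eq_one])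
  refine ⟨fun _ => K, fun _ => inferInstance, fun _ => inferInstance, fun _ => hK, ?_⟩
  subst hfu
  exact nonempty_algEquiv_adjoinRoot_prod_matrix hp hm0.ne' lam bs hbs hx hy hyx hζ ru ℓu hru hℓu
    hrm hK htrans
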